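/- For every integer n ≥ 2, τ(n) equals the minimum, over all odd positive divisors d of n(n+1) with d ≠ n and d ≠ n+1, of the quantity (max(d, e) - min(d, e) - 1)/2 where e = n(n+1)/d; equivalently, τ(n) = min over such d of (|d - n(n+1)/d| - 1)/2. -/

import Mathlib

/-- The triangular number `T m = m(m+1)/2`. -/
def T (m : ℕ) : ℕ := m * (m + 1) / 2

theorem two_mul_T (m : ℕ) : 2 * T m = m * (m + 1) :=
  Nat.mul_div_cancel' (Nat.even_mul_succ_self m).two_dvd

/-- The sum `T n + T k` is triangular iff `n(n+1)` has two complementary divisors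
at distance `2k + 1`. -/
theorem exists_T_add_eq_T_iff (n k : ℕ) :
    (∃ m, T n + T k = T m) ↔ ∃ a, a * (a + (2 * k + 1)) = n * (n + 1) := by
  constructor
  · rintro ⟨m, hm⟩
    have h : n * (n + 1) + k * (k + 1) = m * (m + 1) := by
      rw [← two_mul_T, ← two_mul_T, ← two_mul_T, ← hm, mul_add]
    have hkm : k ≤ m := by
      by_contra! hlt
      nlinarith
    obtain ⟨a, rfl⟩ := Nat.exists_eq_add_of_le hkm
    exact ⟨a, by linarith⟩
  · rintro ⟨a, ha⟩
    refine ⟨k + a, ?_⟩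
    have hn := two_mul_T n
    have hk := two_mul_T k
    have hm := two_mul_T (k + a)
    linarith

/-- Two numbers with product `n(n+1)` that differ by one are `n` and `n+1`. -/
theorem eq_of_mul_succ_eq {a n : ℕ} (h : a * (a + 1) = n * (n + 1)) : a = n := by
  rcases lt_trichotomy a n with hlt | heq | hlt
  · nlinarith
  · exact heq
  · nlinarith

theorem setOf_T_add_eq_T_eq_setOf_divisors (n : ℕ) (hn : 2 ≤ n) :
    {k : ℕ | 0 < k ∧ ∃ m : ℕ, T n + T k = T m} =
      {k : ℕ | ∃ d : ℕ, 0 < d ∧ d ∣ n * (n + 1) ∧ Odd d ∧ d ≠ n ∧ d ≠ n + 1 ∧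
        k = (max d (n * (n + 1) / d) - min d (n * (n + 1) / d) - 1) / 2} := by
  have hpos : 0 < n * (n + 1) := by positivity
  ext k
  simp only [Set.mem_ofPred_eq, exists_T_add_eq_T_iff]
  constructor
  · rintro ⟨hk, a, ha⟩
    have ha0 : 0 < a := by
      rcases Nat.eq_zero_or_pos a with rfl | h
      · omega
      · exact h
    have han : a ≠ n := by
      rintro rfl
      nlinarith
    have han' : a ≠ n + 1 := by
      rintro rfl
      nlinarith
    rcases Nat.even_or_odd a with hev | hodd
    · have hdiv : n * (n + 1) / (a + (2 * k + 1)) = a := by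
        rw [← ha, Nat.mul_div_cancel _ (by omega)]
      refine ⟨a + (2 * k + 1), by omega, ⟨a, by rw [← ha, mul_comm]⟩,
        hev.add_odd ⟨k, rfl⟩, ?_, ?_, ?_⟩
      · intro h
        rw [h] at ha
        nlinarith
      · intro h
        rw [h] at ha
        exact han (Nat.eq_of_mul_eq_mul_right (by omega) ha)
      · rw [hdiv]
        omega
    · have hdiv : n * (n + 1) / a = a + (2 * k + 1) := by
        rw [← ha, Nat.mul_div_cancel_left _ ha0]
      refine ⟨a, ha0, ⟨_, ha.symm⟩, hodd, han, han', ?_⟩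
      rw [hdiv]
      omega
  · rintro ⟨d, hd0, ⟨e, he⟩, hodd, hdn, hdn', hk⟩
    rw [he, Nat.mul_div_cancel_left _ hd0] at hk
    have heven : Even e := by
      have h := Nat.even_mul_succ_self n
      rw [he, Nat.even_mul] at h
      exact h.resolve_left (Nat.not_even_iff_odd.mpr hodd)
    obtain ⟨x, rfl⟩ := hodd
    obtain ⟨y, rfl⟩ := heven
    rcases le_total (2 * x + 1) (y + y) with hle | hle
    · have hde : y + y = 2 * x + 1 + (2 * k + 1) := by omega
      rw [hde] at he
      refine ⟨Nat.pos_of_ne_zero ?_, _, he.symm⟩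
      rintro rfl
      exact hdn (eq_of_mul_succ_eq he.symm)
    · have hde : 2 * x + 1 = y + y + (2 * k + 1) := by omega
      rw [hde, mul_comm (y + y + (2 * k + 1))] at he
      refine ⟨Nat.pos_of_ne_zero ?_, _, he.symm⟩
      rintro rfl
      have := eq_of_mul_succ_eq he.symm
      omega

/-- For `n ≥ 2`, `τ(n)` (the least positive `k` with `T n + T k` triangular)
equals the minimum, over all odd positive divisors `d` of `n(n+1)` with `d ≠ n` and
`d ≠ n+1`, of `(max(d,e) - min(d,e) - 1)/2` where `e = n(n+1)/d`. -/
theorem tau_via_divisors (n : ℕ) (hn : 2 ≤ n) :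
    IsLeast {k : ℕ | 0 < k ∧ ∃ m : ℕ, T n + T k = T m}
      (sInf {k : ℕ | ∃ d : ℕ, 0 < d ∧ d ∣ n * (n + 1) ∧ Odd d ∧ d ≠ n ∧ d ≠ n + 1 ∧
        k = (max d (n * (n + 1) / d) - min d (n * (n + 1) / d) - 1) / 2}) := by
  rw [setOf_T_add_eq_T_eq_setOf_divisors n hn]
  refine ⟨Nat.sInf_mem ⟨_, 1, one_pos, one_dvd _, odd_one, ?_, ?_, rfl⟩, fun _ => Nat.sInf_le⟩
  · omega
  · omega
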